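/- Let p be a prime with p ≡ 1 (mod 4), n an even positive integer, and f : F_{p^n} → F_p a weakly regular bent function with W_f(b) = u p^{n/2} ω_p^{f*(b)} for all b (u ∈ {1,−1}), such that f(tx) = t^k f(x) for all t ∈ F_p, x ∈ F_{p^n} with gcd(k−1,p−1) = 1. Then in the complex group algebra ℂ[(F_{p^n},+)]: L_R² = u·p^{n/2}·(((p−5)/4)·L_R + ((p−1)/4)·L_N) + ((p−1)/2)·p^n·[0]; L_N² = u·p^{n/2}·(((p−1)/4)·L_R + ((p−5)/4)·L_N) + ((p−1)/2)·p^n·[0]; and L_R·L_N = u·p^{n/2}·(((p−1)/4)·L_R + ((p−1)/4)·L_N). -/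

import Mathlib

open Finset

noncomputable section
open scoped Classical

noncomputable instance (p n : ℕ) [Fact p.Prime] : Fintype (GaloisField p n) :=
  Fintype.ofFinite _

/-- `ω_p^a` for `a ∈ F_p`, where `ω_p = exp(2πi/p)`. -/
def ez (p : ℕ) (a : ZMod p) : ℂ :=
  Complex.exp (2 * Real.pi * Complex.I * (a.val : ℂ) / p)

/-- The Walsh coefficient `W_f(b) = ∑_{x∈F_{p^n}} ω_p^{f(x)+Tr(bx)}`. -/
def walsh (p n : ℕ) [Fact p.Prime] (f : GaloisField p n → ZMod p) (b : GaloisField p n) : ℂ :=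
  ∑ x : GaloisField p n,
    ez p (f x + Algebra.trace (ZMod p) (GaloisField p n) (b * x))

/-- The quadratic Gauss sum `G = ∑_{t∈F_p} ω_p^{t²}`. -/
def gaussSum' (p : ℕ) [NeZero p] : ℂ := ∑ t : ZMod p, ez p (t ^ 2)

/-- `L_t = ∑_{x∈F_{p^n}} ω_p^{t f(x)} x`, as an element of the group algebra
`ℂ[(F_{p^n},+)]`. -/
def Lelt (p n : ℕ) [Fact p.Prime] (f : GaloisField p n → ZMod p) (t : ZMod p) :
    AddMonoidAlgebra ℂ (GaloisField p n) :=
  ∑ x : GaloisField p n, AddMonoidAlgebra.single x (ez p (t * f x))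

/-- `L_R = ∑_{t∈R} L_t`, `R` the set of nonzero squares of `F_p`. -/
def LR (p n : ℕ) [Fact p.Prime] (f : GaloisField p n → ZMod p) :
    AddMonoidAlgebra ℂ (GaloisField p n) :=
  ∑ t ∈ Finset.univ.filter fun t : ZMod p => t ≠ 0 ∧ IsSquare t, Lelt p n f t

/-- `L_N = ∑_{t∈N} L_t`, `N` the set of nonsquares of `F_p`. -/
def LN (p n : ℕ) [Fact p.Prime] (f : GaloisField p n → ZMod p) :
    AddMonoidAlgebra ℂ (GaloisField p n) :=
  ∑ t ∈ Finset.univ.filter fun t : ZMod p => ¬IsSquare t, Lelt p n f t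

lemma ez_eq_stdAddChar (p : ℕ) [NeZero p] (a : ZMod p) : ez p a = ZMod.stdAddChar a := by
  rw [ez, ZMod.stdAddChar_apply, ZMod.toCircle_apply]

lemma sum_ez_mul (p : ℕ) [Fact p.Prime] (c : ZMod p) :
    ∑ t : ZMod p, ez p (t * c) = if c = 0 then (p : ℂ) else 0 := by
  simp_rw [ez_eq_stdAddChar]
  rw [AddChar.sum_mulShift c (ZMod.isPrimitive_stdAddChar p), ZMod.card]
  split_ifs <;> simp

/-- The Gaussian period attached to the nonzero squares, evaluated at `c`. -/
def squarePeriod (p : ℕ) [NeZero p] (c : ZMod p) : ℂ :=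
  ∑ r ∈ Finset.univ.filter fun r : ZMod p => r ≠ 0 ∧ IsSquare r, ez p (r * c)

/-- The Gaussian period attached to the nonsquares, evaluated at `c`. -/
def nonsquarePeriod (p : ℕ) [NeZero p] (c : ZMod p) : ℂ :=
  ∑ r ∈ Finset.univ.filter fun r : ZMod p => ¬IsSquare r, ez p (r * c)

lemma squarePeriod_add_nonsquarePeriod (p : ℕ) [Fact p.Prime] (c : ZMod p) :
    squarePeriod p c + nonsquarePeriod p c + 1 = if c = 0 then (p : ℂ) else 0 := by
  have h1 : (1 : ℂ) = ∑ t : ZMod p, if t = 0 then (1 : ℂ) else 0 := by simp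
  rw [← sum_ez_mul, h1, squarePeriod, nonsquarePeriod, Finset.sum_filter, Finset.sum_filter,
    ← Finset.sum_add_distrib, ← Finset.sum_add_distrib]
  refine Finset.sum_congr rfl fun t _ => ?_
  by_cases ht : t = 0
  · simp [ht, ez]
  · by_cases hs : IsSquare t <;> simp [ht, hs]

lemma squarePeriod_sub_nonsquarePeriod (p : ℕ) [Fact p.Prime] (c : ZMod p) :
    squarePeriod p c - nonsquarePeriod p c
      = ∑ t : ZMod p, ((quadraticChar (ZMod p) t : ℤ) : ℂ) * ez p (t * c) := by
  rw [squarePeriod, nonsquarePeriod, Finset.sum_filter, Finset.sum_filter,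
    ← Finset.sum_sub_distrib]
  refine Finset.sum_congr rfl fun t _ => ?_
  by_cases ht : t = 0
  · simp [ht]
  · by_cases hs : IsSquare t
    · simp [ht, hs, (quadraticChar_one_iff_isSquare ht).2 hs]
    · simp [hs, quadraticChar_neg_one_iff_not_isSquare.2 hs]

lemma squarePeriod_sub_nonsquarePeriod_sq (p : ℕ) [Fact p.Prime] (hp4 : p % 4 = 1) (c : ZMod p) :
    (squarePeriod p c - nonsquarePeriod p c) ^ 2 = if c = 0 then 0 else (p : ℂ) := by
  have hchar : ringChar (ZMod p) ≠ 2 := by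
    rw [ZMod.ringChar_zmod_n]; omega
  rw [squarePeriod_sub_nonsquarePeriod]
  split_ifs with hc
  · have h := quadraticChar_sum_zero hchar
    have h' : (∑ t : ZMod p, ((quadraticChar (ZMod p) t : ℤ) : ℂ)) = 0 := by exact_mod_cast h
    simpa [hc, ez] using h'
  · set χ := (quadraticChar (ZMod p)).ringHomComp (Int.castRingHom ℂ)
    have hχ₁ : χ ≠ 1 := (MulChar.ringHomComp_ne_one_iff (RingHom.injective_int _)).2
      (quadraticChar_ne_one hchar)
    have hχ₂ : χ.IsQuadratic := (quadraticChar_isQuadratic (ZMod p)).comp _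
    have hψ : (AddChar.mulShift (ZMod.stdAddChar (N := p)) c).IsPrimitive :=
      AddChar.IsPrimitive.of_ne_one (ZMod.isPrimitive_stdAddChar p hc)
    have h := gaussSum_sq hχ₁ hχ₂ hψ
    have hneg : χ (-1) = 1 := by
      simp [χ, quadraticChar_neg_one hchar, ZMod.card, ZMod.χ₄_nat_one_mod_four hp4]
    rw [hneg, ZMod.card, one_mul] at h
    rw [← h, gaussSum]
    congr 1
    refine Finset.sum_congr rfl fun t _ => ?_
    rw [ez_eq_stdAddChar, AddChar.mulShift_apply, mul_comm c]
    rfl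

/-- A rational value of the form `C * ω_p^c` of a sum of `p`-th roots of unity is compatible with
the Galois action `ω_p ↦ ω_p^s`. -/
lemma sum_ez_galois {ι : Type*} [Fintype ι] (p : ℕ) [Fact p.Prime] (g : ι → ZMod p) (C : ℚ)
    (c : ZMod p) (h : ∑ i, ez p (g i) = (C : ℂ) * ez p c) {s : ZMod p} (hs : s ≠ 0) :
    ∑ i, ez p (s * g i) = (C : ℂ) * ez p (s * c) := by
  have hp : p.Prime := Fact.out
  set ζ : ℂ := Complex.exp (2 * Real.pi * Complex.I / p) with hζ
  have hprim : IsPrimitiveRoot ζ p := Complex.isPrimitiveRoot_exp p hp.ne_zero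
  have hez : ∀ a : ZMod p, ez p a = ζ ^ a.val := by
    intro a
    rw [ez, hζ, ← Complex.exp_nat_mul]
    congr 1; ring
  have hezs : ∀ a : ZMod p, ez p (s * a) = (ζ ^ s.val) ^ a.val := by
    intro a
    rw [hez, ← pow_mul, ZMod.val_mul, ← pow_mod_orderOf ζ (s.val * a.val), ← hprim.eq_orderOf]
  have hprims : IsPrimitiveRoot (ζ ^ s.val) p := by
    refine hprim.pow_of_coprime _ ((Nat.Coprime.symm ?_))
    refine (Nat.Prime.coprime_iff_not_dvd hp).2 fun hd => hs ?_
    exact (ZMod.val_eq_zero s).1 (Nat.eq_zero_of_dvd_of_lt hd (ZMod.val_lt s))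
  set P : Polynomial ℚ := ∑ i, Polynomial.X ^ (g i).val -
    Polynomial.C C * Polynomial.X ^ c.val
  have hP : Polynomial.aeval ζ P = 0 := by
    simp only [hez] at h
    simp [P, h]
  have hdvd : minpoly ℚ ζ ∣ P := minpoly.dvd ℚ ζ hP
  rw [← Polynomial.cyclotomic_eq_minpoly_rat hprim hp.pos,
    Polynomial.cyclotomic_eq_minpoly_rat hprims hp.pos] at hdvd
  have hPs : Polynomial.aeval (ζ ^ s.val) P = 0 :=
    Polynomial.aeval_eq_zero_of_dvd_aeval_eq_zero hdvd (minpoly.aeval ℚ _)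
  simp only [hezs]
  simpa [P, sub_eq_zero] using hPs

/-- The additive character `x ↦ ω_p^{Tr(x)}` of `F_{p^n}`. -/
def traceChar (p n : ℕ) [Fact p.Prime] : AddChar (GaloisField p n) ℂ :=
  (ZMod.stdAddChar (N := p)).compAddMonoidHom
    (Algebra.trace (ZMod p) (GaloisField p n)).toAddMonoidHom

lemma traceChar_apply (p n : ℕ) [Fact p.Prime] (x : GaloisField p n) :
    traceChar p n x = ez p (Algebra.trace (ZMod p) (GaloisField p n) x) := by
  rw [ez_eq_stdAddChar]; rfl

lemma traceChar_isPrimitive (p n : ℕ) [Fact p.Prime] : (traceChar p n).IsPrimitive := by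
  refine AddChar.IsPrimitive.of_ne_one (AddChar.ne_one_iff.2 ?_)
  obtain ⟨x, hx⟩ := Algebra.trace_surjective (ZMod p) (GaloisField p n) 1
  refine ⟨x, fun h => ?_⟩
  rw [traceChar_apply, hx, ez_eq_stdAddChar, ← (ZMod.stdAddChar (N := p)).map_zero_eq_one] at h
  exact one_ne_zero (ZMod.injective_stdAddChar h)

/-- The extension to the group algebra of the character `x ↦ ω_p^{Tr(bx)}`. -/
def traceFourier (p n : ℕ) [Fact p.Prime] (b : GaloisField p n) :
    AddMonoidAlgebra ℂ (GaloisField p n) →ₐ[ℂ] ℂ :=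
  AddMonoidAlgebra.lift ℂ ℂ (GaloisField p n) ((traceChar p n).mulShift b).toMonoidHom

lemma traceFourier_single (p n : ℕ) [Fact p.Prime] (b x : GaloisField p n) (a : ℂ) :
    traceFourier p n b (AddMonoidAlgebra.single x a) = a * traceChar p n (b * x) := by
  rw [traceFourier, AddMonoidAlgebra.lift_single, smul_eq_mul]; rfl

lemma traceFourier_apply (p n : ℕ) [Fact p.Prime] (b : GaloisField p n)
    (g : AddMonoidAlgebra ℂ (GaloisField p n)) :
    traceFourier p n b g = ∑ x, g.coeff x * traceChar p n (b * x) := by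
  rw [traceFourier, AddMonoidAlgebra.lift_apply, Finsupp.sum_fintype _ _ (by simp)]
  rfl

lemma traceFourier_inversion (p n : ℕ) [Fact p.Prime] (g : AddMonoidAlgebra ℂ (GaloisField p n))
    (y : GaloisField p n) :
    ∑ b, traceFourier p n b g * traceChar p n (-(b * y))
      = (Fintype.card (GaloisField p n) : ℂ) * g.coeff y := by
  simp_rw [traceFourier_apply, Finset.sum_mul]
  rw [Finset.sum_comm]
  have : ∀ x : GaloisField p n,
      ∑ b, g.coeff x * traceChar p n (b * x) * traceChar p n (-(b * y))
        = if x = y then (Fintype.card (GaloisField p n) : ℂ) * g.coeff y else 0 := by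
    intro x
    have h := AddChar.sum_mulShift (x - y) (traceChar_isPrimitive p n)
    simp_rw [mul_assoc, ← AddChar.map_add_eq_mul, ← sub_eq_add_neg, ← mul_sub, ← Finset.mul_sum, h]
    by_cases hxy : x = y
    · simp [hxy, mul_comm]
    · simp [hxy, sub_eq_zero]
  simp [this]

lemma traceFourier_ext (p n : ℕ) [Fact p.Prime] {g h : AddMonoidAlgebra ℂ (GaloisField p n)}
    (hgh : ∀ b, traceFourier p n b g = traceFourier p n b h) : g = h := by
  ext y
  have hc : (Fintype.card (GaloisField p n) : ℂ) ≠ 0 := by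
    exact_mod_cast Fintype.card_ne_zero
  refine mul_left_cancel₀ hc ?_
  simp_rw [← traceFourier_inversion, hgh]

lemma traceFourier_Lelt (p n : ℕ) [Fact p.Prime] (f : GaloisField p n → ZMod p) (t : ZMod p)
    (b : GaloisField p n) :
    traceFourier p n b (Lelt p n f t)
      = ∑ x, ez p (t * f x + Algebra.trace (ZMod p) (GaloisField p n) (b * x)) := by
  simp only [Lelt, map_sum, traceFourier_single, traceChar_apply]
  simp only [ez_eq_stdAddChar, AddChar.map_add_eq_mul]

lemma traceFourier_Lelt_inv_pow (p n : ℕ) [Fact p.Prime] (f fstar : GaloisField p n → ZMod p) (C : ℚ)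
    (hW : ∀ b, walsh p n f b = (C : ℂ) * ez p (fstar b)) (m : ℕ)
    (hhom : ∀ (t : ZMod p) (x : GaloisField p n),
      f (algebraMap (ZMod p) (GaloisField p n) t * x) = t ^ (m + 1) * f x)
    (b : GaloisField p n) {r : ZMod p} (hr : r ≠ 0) :
    traceFourier p n b (Lelt p n f (r⁻¹ ^ m)) = (C : ℂ) * ez p (r * fstar b) := by
  have ha : algebraMap (ZMod p) (GaloisField p n) r⁻¹ ≠ 0 := by simpa using hr
  rw [traceFourier_Lelt, ← sum_ez_galois p _ C (fstar b) (hW b) hr]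
  refine Fintype.sum_equiv (Equiv.mulLeft₀ _ ha) _ _ fun x => ?_
  congr 1
  have htr : b * (algebraMap (ZMod p) (GaloisField p n) r⁻¹ * x) = r⁻¹ • (b * x) := by
    rw [Algebra.smul_def]; ring
  simp only [Equiv.mulLeft₀_apply, hhom, htr, map_smul, smul_eq_mul]
  have hri : r * r⁻¹ = 1 := mul_inv_cancel₀ hr
  linear_combination (-r⁻¹ ^ m * f x
    - Algebra.trace (ZMod p) (GaloisField p n) (b * x)) * hri

lemma inv_pow_bijective (p : ℕ) [Fact p.Prime] {m : ℕ} (hm : m ≠ 0) (hmp : m.Coprime (p - 1)) :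
    Function.Bijective fun r : ZMod p => r⁻¹ ^ m := by
  refine Finite.injective_iff_bijective.1 fun r s h => ?_
  simp only [inv_pow, inv_inj] at h
  by_cases hr : r = 0
  · rw [hr, zero_pow hm] at h
    rw [hr, eq_comm, ← pow_eq_zero_iff hm, ← h]
  by_cases hs : s = 0
  · rw [hs, zero_pow hm] at h
    exact absurd ((pow_eq_zero_iff hm).1 h) hr
  have hcop : (Nat.card (ZMod p)ˣ).Coprime m := by
    rw [Nat.card_eq_fintype_card, ZMod.card_units]
    exact hmp.symm
  have := hcop.pow_left_bijective.injective (a₁ := Units.mk0 r hr) (a₂ := Units.mk0 s hs)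
    (Units.ext (by simpa using h))
  simpa using congrArg Units.val this

lemma isSquare_inv_pow_iff {F : Type*} [Field F] {m : ℕ} (hm : Odd m) (r : F) :
    IsSquare (r⁻¹ ^ m) ↔ IsSquare r := by
  refine ⟨fun h => ?_, fun h => h.inv.pow m⟩
  by_cases hr : r = 0
  · simp [hr]
  obtain ⟨j, rfl⟩ := hm
  have : r = r⁻¹ ^ (2 * j + 1) * (r ^ (j + 1) * r ^ (j + 1)) := by
    have h1 : r⁻¹ ^ (2 * j + 1) * r ^ (2 * j + 1) = 1 := by
      rw [← mul_pow, inv_mul_cancel₀ hr, one_pow]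
    linear_combination -r * h1
  rw [this]
  exact h.mul ⟨_, rfl⟩


/-- Identities (2.8)–(2.10) (`p ≡ 1 (mod 4)`): in `ℂ[(F_{p^n},+)]`,
`L_R² = u p^{n/2}(((p−5)/4)L_R + ((p−1)/4)L_N) + ((p−1)/2)p^n·[0]`,
`L_N² = u p^{n/2}(((p−1)/4)L_R + ((p−5)/4)L_N) + ((p−1)/2)p^n·[0]`, and
`L_R L_N = u p^{n/2}(((p−1)/4)L_R + ((p−1)/4)L_N)`. -/
theorem LR_LN_identities_one_mod_four
    (p : ℕ) [Fact p.Prime] (hp4 : p % 4 = 1) (n : ℕ) (hn : 0 < n) (hneven : Even n)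
    (f fstar : GaloisField p n → ZMod p) (u : ℤ) (hu : u = 1 ∨ u = -1)
    (hW : ∀ b : GaloisField p n,
      walsh p n f b = (u : ℂ) * (p : ℂ) ^ (n / 2) * ez p (fstar b))
    (k : ℕ) (hk : 0 < k) (hkgcd : Nat.gcd (k - 1) (p - 1) = 1)
    (hhom : ∀ (t : ZMod p) (x : GaloisField p n),
      f (algebraMap (ZMod p) (GaloisField p n) t * x) = t ^ k * f x) :
    LR p n f ^ 2
      = ((u : ℂ) * (p : ℂ) ^ (n / 2)) •
          ((((p : ℂ) - 5) / 4) • LR p n f + (((p : ℂ) - 1) / 4) • LN p n f)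
        + (((p : ℂ) - 1) / 2 * (p : ℂ) ^ n) • (1 : AddMonoidAlgebra ℂ (GaloisField p n)) ∧
    LN p n f ^ 2
      = ((u : ℂ) * (p : ℂ) ^ (n / 2)) •
          ((((p : ℂ) - 1) / 4) • LR p n f + (((p : ℂ) - 5) / 4) • LN p n f)
        + (((p : ℂ) - 1) / 2 * (p : ℂ) ^ n) • (1 : AddMonoidAlgebra ℂ (GaloisField p n)) ∧
    LR p n f * LN p n f
      = ((u : ℂ) * (p : ℂ) ^ (n / 2)) •
          ((((p : ℂ) - 1) / 4) • LR p n f + (((p : ℂ) - 1) / 4) • LN p n f) := by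
  obtain ⟨m, rfl⟩ : ∃ m, k = m + 1 := ⟨k - 1, by omega⟩
  rw [Nat.add_sub_cancel] at hkgcd
  have hmodd : Odd m := by
    rw [← Nat.not_even_iff_odd, even_iff_two_dvd]
    intro h2
    have := Nat.dvd_gcd h2 (show 2 ∣ p - 1 by omega)
    omega
  have hm : m ≠ 0 := by rintro rfl; simp at hmodd
  have hbij := inv_pow_bijective p hm hkgcd
  set q : ℂ := (u : ℂ) * (p : ℂ) ^ (n / 2) with hq
  have hqC : q = (((u : ℚ) * (p : ℚ) ^ (n / 2) : ℚ) : ℂ) := by simp [hq]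
  have hq2 : q ^ 2 = (p : ℂ) ^ n := by
    have hu2 : (u : ℂ) ^ 2 = 1 := by rcases hu with rfl | rfl <;> simp
    rw [hq, mul_pow, hu2, one_mul, ← pow_mul, Nat.div_mul_cancel hneven.two_dvd]
  have hL : ∀ b (r : ZMod p), r ≠ 0 →
      q * ez p (r * fstar b) = traceFourier p n b (Lelt p n f (r⁻¹ ^ m)) := by
    intro b r hr
    rw [hqC] at hW ⊢
    exact (traceFourier_Lelt_inv_pow p n f fstar _ hW m hhom b hr).symm
  have hR : ∀ b, traceFourier p n b (LR p n f) = q * squarePeriod p (fstar b) := by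
    intro b
    rw [LR, map_sum, squarePeriod, Finset.mul_sum]
    refine (Finset.sum_bijective _ hbij (fun r => ?_) fun r hr => ?_).symm
    · simp [isSquare_inv_pow_iff hmodd, hm, -inv_pow]
    · exact hL b r (Finset.mem_filter.1 hr).2.1
  have hN : ∀ b, traceFourier p n b (LN p n f) = q * nonsquarePeriod p (fstar b) := by
    intro b
    rw [LN, map_sum, nonsquarePeriod, Finset.mul_sum]
    refine (Finset.sum_bijective _ hbij (fun r => ?_) fun r hr => ?_).symm
    · simp only [Finset.mem_filter, Finset.mem_univ, true_and, isSquare_inv_pow_iff hmodd]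
    · refine hL b r ?_
      rintro rfl
      simp at hr
  have key : ∀ c : ZMod p,
      squarePeriod p c ^ 2 = ((p : ℂ) - 5) / 4 * squarePeriod p c
        + ((p : ℂ) - 1) / 4 * nonsquarePeriod p c + ((p : ℂ) - 1) / 2 ∧
      nonsquarePeriod p c ^ 2 = ((p : ℂ) - 1) / 4 * squarePeriod p c
        + ((p : ℂ) - 5) / 4 * nonsquarePeriod p c + ((p : ℂ) - 1) / 2 ∧
      squarePeriod p c * nonsquarePeriod p c = ((p : ℂ) - 1) / 4 * squarePeriod p c
        + ((p : ℂ) - 1) / 4 * nonsquarePeriod p c := by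
    intro c
    have hadd := squarePeriod_add_nonsquarePeriod p c
    have hsub := squarePeriod_sub_nonsquarePeriod_sq p hp4 c
    generalize squarePeriod p c = A at *
    generalize nonsquarePeriod p c = B at *
    split_ifs at hadd hsub
    · have hAB : A = B := sub_eq_zero.1 (pow_eq_zero_iff two_ne_zero |>.1 hsub)
      have hB : (p : ℂ) = 2 * B + 1 := by rw [← hadd, hAB]; ring
      rw [hAB, hB]
      refine ⟨?_, ?_, ?_⟩ <;> ring
    · have hB : B = -1 - A := by linear_combination hadd
      have hpA : (p : ℂ) = (2 * A + 1) ^ 2 := by rw [← hsub, hB]; ring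
      rw [hB, hpA]
      refine ⟨?_, ?_, ?_⟩ <;> ring
  refine ⟨traceFourier_ext p n fun b => ?_, traceFourier_ext p n fun b => ?_, traceFourier_ext p n fun b => ?_⟩ <;>
    obtain ⟨h1, h2, h3⟩ := key (fstar b) <;>
    simp only [map_add, map_mul, map_pow, map_smul, map_one, smul_eq_mul, hR, hN, ← hq2]
  · linear_combination q ^ 2 * h1
  · linear_combination q ^ 2 * h2
  · linear_combination q ^ 2 * h3
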